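/- arXiv:1703.02950 — 4 statements merged into one kernel-verified Lean document; each statement's English description precedes it below -/
import Mathlib

section
/- Let 𝔟 = (𝗄, 𝗅, β) be a basic moduli specification with 𝗄 ⊂ ℕ and let r ≥ 0. For every odd-even (𝔟, r)-labeled tree 𝒯 there exists at least one permutation τ ∈ Sym(r) such that the relabeled tree τ.𝒯 is sorted. (Proposition "sorted is good", part (a).) -/
/-!
Basic combinatorial set-up for `(𝔟, r)`-labeled trees.

We fix a basic moduli specification `𝔟 = (𝗄, 𝗅, β)` with `𝗄 ⊂ ℕ`, encoded by a pair of
finite sets `kk ll : Finset ℕ` and a natural number `β`.  For `r ≥ 0`, a `(𝔟, r)`-labeled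
tree has vertices `v_1, …, v_{r+1}` (encoded by `Fin (r+1)`) and oriented labeled edges
`e_1, …, e_r` (encoded by `Fin r`).  The boundary markings attached to a vertex form a
finite subset of `𝗄 ⊔ {★″_1, …, ★″_r}`, encoded as `Finset (ℕ ⊕ Fin r)` with `Sum.inr j`
playing the role of `★″_j`; the superfluous markings `★′_j` attached to a vertex are
encoded by their index set, a `Finset (Fin r)`.
-/

/-- The simple graph on the vertex set `V` generated by the oriented edges in `E`;
edge `e` joins `tail e` to `head e`. -/
def treeGraph {r : ℕ} {V : Type*} (tail head : Fin r → V) (E : Finset (Fin r)) :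
    SimpleGraph V :=
  SimpleGraph.fromRel (fun x y => ∃ e ∈ E, tail e = x ∧ head e = y)

/-- A `(𝔟, r)`-labeled tree for the basic moduli specification `𝔟 = (kk, ll, β)`.
Each vertex `i` carries a sturdy moduli specification
`((kv i, lv i, bv i), sv i)`; the vertex `i` is the head (resp. tail) of the edge `e`
iff `★″_e ∈ kv i` (resp. `★′_e ∈ sv i`); the `kv i` partition `kk ⊔ {★″_1, …, ★″_r}`,
the `lv i` partition `ll`, the `sv i` partition `{★′_1, …, ★′_r}` and `∑ bv i = β`;
the resulting graph is a tree (it has `r` edges on `r + 1` vertices, so this is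
connectivity); and the vertex labels satisfy condition (c). -/
structure LabeledTree (kk ll : Finset ℕ) (β r : ℕ) where
  kv : Fin (r + 1) → Finset (ℕ ⊕ Fin r)
  lv : Fin (r + 1) → Finset ℕ
  bv : Fin (r + 1) → ℕ
  sv : Fin (r + 1) → Finset (Fin r)
  head : Fin r → Fin (r + 1)
  tail : Fin r → Fin (r + 1)
  mem_head : ∀ (e : Fin r) (i : Fin (r + 1)), Sum.inr e ∈ kv i ↔ head e = i
  mem_tail : ∀ (e : Fin r) (i : Fin (r + 1)), e ∈ sv i ↔ tail e = i
  sturdy : ∀ i, 3 ≤ (kv i).card + 2 * (lv i).card + 3 * bv i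
  orient : ∀ i, Odd ((kv i).card + bv i)
  kv_disjoint : ∀ i j, i ≠ j → Disjoint (kv i) (kv j)
  kv_union : Finset.univ.biUnion kv
      = kk.image Sum.inl ∪ (Finset.univ : Finset (Fin r)).image Sum.inr
  lv_disjoint : ∀ i j, i ≠ j → Disjoint (lv i) (lv j)
  lv_union : Finset.univ.biUnion lv = ll
  sv_disjoint : ∀ i j, i ≠ j → Disjoint (sv i) (sv j)
  sv_union : Finset.univ.biUnion sv = (Finset.univ : Finset (Fin r))
  bv_sum : ∑ i, bv i = β
  connected : (treeGraph tail head Finset.univ).Connected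
  cond_c : ∀ (a : Fin r) (x y : Fin (r + 1)),
    (treeGraph tail head (Finset.univ.filter (fun e => e < a))).Reachable (tail a) x →
    (treeGraph tail head (Finset.univ.filter (fun e => e < a))).Reachable (head a) y →
    x < y

/-- A labeled tree is *odd-even* if every vertex of even degree carries no superfluous
markings `★′`, and every vertex of odd degree carries no boundary markings. -/
def IsOddEven {kk ll : Finset ℕ} {β r : ℕ} (T : LabeledTree kk ll β r) : Prop :=
  ∀ i, (Even (T.bv i) → T.sv i = ∅) ∧ (Odd (T.bv i) → T.kv i = ∅)

/-- A labeled tree is *sorted* if the graph spanned by the edges `e_1, …, e_a` is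
connected for every `1 ≤ a ≤ r`, and the set of `★′`-indices at each vertex is an
interval. -/
def IsSorted {kk ll : Finset ℕ} {β r : ℕ} (T : LabeledTree kk ll β r) : Prop :=
  (∀ a : Fin r, ∀ x y : Fin (r + 1),
      (∃ e : Fin r, e ≤ a ∧ (T.tail e = x ∨ T.head e = x)) →
      (∃ e : Fin r, e ≤ a ∧ (T.tail e = y ∨ T.head e = y)) →
      (treeGraph T.tail T.head (Finset.univ.filter (fun e => e ≤ a))).Reachable x y) ∧
  (∀ v : Fin (r + 1), ∀ i a j : Fin r,
      i ∈ T.sv v → j ∈ T.sv v → i ≤ a → a ≤ j → a ∈ T.sv v)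

namespace treeGraph

variable {r : ℕ} {V : Type*} {t h : Fin r → V} {E : Finset (Fin r)}

lemma reachable_of_mem {e : Fin r} (he : e ∈ E) :
    (treeGraph t h E).Reachable (t e) (h e) := by
  by_cases hth : t e = h e
  · rw [hth]
  · refine SimpleGraph.Adj.reachable ?_
    rw [treeGraph, SimpleGraph.fromRel_adj]
    exact ⟨hth, Or.inl ⟨e, he, rfl, rfl⟩⟩

/-- A graph that joins the two ends of every edge in `E` joins everything that `E` joins. -/
lemma reachable_of_forall_mem {G : SimpleGraph V} (hG : ∀ e ∈ E, G.Reachable (t e) (h e))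
    {x y : V} (hxy : (treeGraph t h E).Reachable x y) : G.Reachable x y := by
  obtain ⟨p⟩ := hxy
  induction p with
  | nil => rfl
  | cons hadj _ ih =>
    refine SimpleGraph.Reachable.trans ?_ ih
    rw [treeGraph, SimpleGraph.fromRel_adj] at hadj
    obtain ⟨-, ⟨e, he, rfl, rfl⟩ | ⟨e, he, rfl, rfl⟩⟩ := hadj
    · exact hG e he
    · exact (hG e he).symm

lemma reachable_mono {F : Finset (Fin r)} (hEF : E ⊆ F) {x y : V}
    (hxy : (treeGraph t h E).Reachable x y) : (treeGraph t h F).Reachable x y :=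
  reachable_of_forall_mem (fun _ he => reachable_of_mem (hEF he)) hxy

lemma reachable_comp_equiv (w : V ≃ V) {x y : V}
    (hxy : (treeGraph (w ∘ t) (w ∘ h) E).Reachable x y) :
    (treeGraph t h E).Reachable (w.symm x) (w.symm y) := by
  have key : ((treeGraph t h E).map w.toEmbedding).Reachable x y := by
    refine reachable_of_forall_mem (fun e he => ?_) hxy
    exact (reachable_of_mem he).map (SimpleGraph.Embedding.map w.toEmbedding _).toHom
  have := key.map (SimpleGraph.Iso.map w (treeGraph t h E)).symm.toHom
  simpa using this

lemma reachable_equiv_comp (w : V ≃ V) {x y : V}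
    (hxy : (treeGraph t h E).Reachable x y) :
    (treeGraph (w ∘ t) (w ∘ h) E).Reachable (w x) (w y) := by
  refine reachable_comp_equiv (t := w ∘ t) (h := w ∘ h) w.symm ?_
  simpa [← Function.comp_assoc] using hxy

lemma connected_equiv_comp (w : V ≃ V) (hc : (treeGraph t h E).Connected) :
    (treeGraph (w ∘ t) (w ∘ h) E).Connected := by
  have := hc.nonempty
  refine SimpleGraph.Connected.mk fun x y => ?_
  simpa using reachable_equiv_comp w (hc.preconnected (w.symm x) (w.symm y))

lemma comp_perm_univ (σ : Equiv.Perm (Fin r)) :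
    treeGraph (t ∘ σ) (h ∘ σ) Finset.univ = treeGraph t h Finset.univ := by
  ext x y
  simp only [treeGraph, SimpleGraph.fromRel_adj, Finset.mem_univ, true_and, Function.comp_apply]
  rw [σ.surjective.exists (p := fun e => t e = x ∧ h e = y),
    σ.surjective.exists (p := fun e => t e = y ∧ h e = x)]

lemma card_le_of_connected [Fintype V] (hc : (treeGraph t h E).Connected) :
    Fintype.card V ≤ E.card + 1 := by
  classical
  have hle := hc.card_vert_le_card_edgeSet_add_one
  rw [Nat.card_eq_fintype_card] at hle
  have hsub : (treeGraph t h E).edgeSet ⊆ (E.image fun e => s(t e, h e) : Finset (Sym2 V)) := by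
    intro z
    induction z with
    | _ x y =>
      rw [SimpleGraph.mem_edgeSet, treeGraph, SimpleGraph.fromRel_adj]
      rintro ⟨-, ⟨e, he, rfl, rfl⟩ | ⟨e, he, rfl, rfl⟩⟩
      · simpa using ⟨e, he, Or.inl ⟨rfl, rfl⟩⟩
      · simpa using ⟨e, he, Or.inr ⟨rfl, rfl⟩⟩
  have hcard := Nat.card_mono (Finset.finite_toSet _) hsub
  rw [SetLike.coe_sort_coe, Nat.card_eq_fintype_card (α := ((E.image _ : Finset _) : Type _)),
    Fintype.card_coe] at hcard
  exact hle.trans (Nat.add_le_add_right (hcard.trans Finset.card_image_le) 1)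

/-- Every edge of a tree is a bridge. -/
lemma not_reachable_of_notMem [Fintype V] (hV : Fintype.card V = r + 1)
    (hc : (treeGraph t h Finset.univ).Connected) {e : Fin r} (he : e ∉ E) :
    ¬ (treeGraph t h E).Reachable (t e) (h e) := by
  intro hreach
  have := hc.nonempty
  have hconn : (treeGraph t h (Finset.univ.erase e)).Connected := by
    refine SimpleGraph.Connected.mk fun x y => ?_
    refine reachable_of_forall_mem (fun f _ => ?_) (hc.preconnected x y)
    by_cases hfe : f = e
    · subst hfe
      refine reachable_mono (fun g hg => ?_) hreach
      exact Finset.mem_erase.2 ⟨fun hgf => he (hgf ▸ hg), Finset.mem_univ g⟩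
    · exact reachable_of_mem (Finset.mem_erase.2 ⟨hfe, Finset.mem_univ f⟩)
  have := card_le_of_connected hconn
  rw [Finset.card_erase_of_mem (Finset.mem_univ e), Finset.card_univ, Fintype.card_fin] at this
  have := e.pos
  omega

/-- A height function on the vertices of a tree which, for each of the first `n` edges, puts the
tail side strictly below the head side. -/
lemma exists_height [Fintype V] (hV : Fintype.card V = r + 1)
    (hc : (treeGraph t h Finset.univ).Connected) (n : ℕ) :
    ∃ f : V → ℕ, ∀ a : Fin r, (a : ℕ) < n → ∀ x y : V,
      (treeGraph t h (Finset.univ.filter (· < a))).Reachable (t a) x →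
      (treeGraph t h (Finset.univ.filter (· < a))).Reachable (h a) y → f x < f y := by
  classical
  induction n with
  | zero => exact ⟨fun _ => 0, fun a ha => absurd ha (Nat.not_lt_zero _)⟩
  | succ n ih =>
    obtain ⟨f, hf⟩ := ih
    by_cases hn : n < r
    · let b : Fin r := ⟨n, hn⟩
      let G := treeGraph t h (Finset.univ.filter (· < b))
      refine ⟨fun x => f x + if G.Reachable (h b) x then (∑ z, f z) + 1 else 0, ?_⟩
      intro a ha x y hx hy
      rcases (Nat.lt_succ_iff_lt_or_eq.1 ha) with hlt | heq
      · have hsub : Finset.univ.filter (· < a) ⊆ Finset.univ.filter (· < b) := by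
          intro e
          simp only [Finset.mem_filter, Finset.mem_univ, true_and]
          exact fun hea => hea.trans hlt
        have hab : G.Reachable (t a) (h a) := reachable_of_mem (by simpa using Fin.lt_def.2 hlt)
        have hxy : G.Reachable x y :=
          (reachable_mono hsub hx).symm.trans (hab.trans (reachable_mono hsub hy))
        have hiff : G.Reachable (h b) x ↔ G.Reachable (h b) y :=
          ⟨fun hbx => hbx.trans hxy, fun hby => hby.trans hxy.symm⟩
        simp only [hiff]
        exact Nat.add_lt_add_right (hf a hlt x y hx hy) _
      · obtain rfl : a = b := Fin.ext heq
        have hnot : ¬ G.Reachable (h b) x := fun hbx =>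
          not_reachable_of_notMem hV hc (E := Finset.univ.filter (· < b)) (e := b) (by simp)
            (hx.trans hbx.symm)
        have hle := Finset.single_le_sum (f := f) (fun z _ => Nat.zero_le (f z))
          (Finset.mem_univ x)
        simp only [if_neg hnot, if_pos (show G.Reachable (h b) y from hy)]
        omega
    · exact ⟨f, fun a _ => hf a (a.isLt.trans_le (not_lt.1 hn))⟩

/-- The vertices of a tree with ordered edges can be ordered so that each edge, among those up to
itself, has its tail side before its head side. -/
lemma exists_vertex_relabeling {t h : Fin r → Fin (r + 1)}
    (hc : (treeGraph t h Finset.univ).Connected) :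
    ∃ w : Equiv.Perm (Fin (r + 1)), ∀ (a : Fin r) (x y : Fin (r + 1)),
      (treeGraph t h (Finset.univ.filter (· < a))).Reachable (t a) x →
      (treeGraph t h (Finset.univ.filter (· < a))).Reachable (h a) y → w x < w y := by
  obtain ⟨f, hf⟩ := exists_height (Fintype.card_fin _) hc r
  refine ⟨(Tuple.sort f).symm, fun a x y hx hy => ?_⟩
  by_contra! hle
  have := Tuple.monotone_sort f hle
  simp only [Function.comp_apply, Equiv.apply_symm_apply] at this
  exact absurd (hf a a.isLt x y hx hy) this.not_gt

lemma exists_edge_dist_lt (hc : (treeGraph t h Finset.univ).Connected) {o v : V} (hv : v ≠ o) :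
    ∃ e, (t e = v ∧ (treeGraph t h Finset.univ).dist o (h e) <
        (treeGraph t h Finset.univ).dist o v) ∨
      (h e = v ∧ (treeGraph t h Finset.univ).dist o (t e) <
        (treeGraph t h Finset.univ).dist o v) := by
  obtain ⟨p, hp⟩ := hc.exists_walk_length_eq_dist v o
  cases p with
  | nil => exact absurd rfl hv
  | @cons _ u _ hadj q =>
    have hlt : (treeGraph t h Finset.univ).dist o u < (treeGraph t h Finset.univ).dist o v := by
      rw [SimpleGraph.dist_comm (v := v), SimpleGraph.dist_comm, ← hp,
        SimpleGraph.Walk.length_cons]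
      exact Nat.lt_succ_of_le (SimpleGraph.dist_le q)
    rw [treeGraph, SimpleGraph.fromRel_adj] at hadj
    obtain ⟨-, ⟨e, -, rfl, rfl⟩ | ⟨e, -, rfl, rfl⟩⟩ := hadj
    · exact ⟨e, Or.inl ⟨rfl, hlt⟩⟩
    · exact ⟨e, Or.inr ⟨rfl, hlt⟩⟩

/-- In a connected graph in which no vertex is both a head and a tail, the edges can be ordered so
that initial segments are connected and edges with a common tail are contiguous. -/
lemma exists_sorted_edge_order [LinearOrder V] (hc : (treeGraph t h Finset.univ).Connected)
    (hth : ∀ e f, t e ≠ h f) :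
    ∃ σ : Equiv.Perm (Fin r),
      (∀ a : Fin r, ∀ x y : V,
        (∃ e, e ≤ a ∧ (t (σ e) = x ∨ h (σ e) = x)) →
        (∃ e, e ≤ a ∧ (t (σ e) = y ∨ h (σ e) = y)) →
        (treeGraph (t ∘ σ) (h ∘ σ) (Finset.univ.filter (· ≤ a))).Reachable x y) ∧
      (∀ i a j : Fin r, t (σ i) = t (σ j) → i ≤ a → a ≤ j → t (σ a) = t (σ i)) := by
  rcases Nat.eq_zero_or_pos r with rfl | hr
  · exact ⟨1, fun a => a.elim0, fun a => a.elim0⟩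
  let o : V := t ⟨0, hr⟩
  let d : V → ℕ := (treeGraph t h Finset.univ).dist o
  let tailKey : Fin r → ℕ ×ₗ V := fun e => toLex (d (t e), t e)
  let key : Fin r → (ℕ ×ₗ V) ×ₗ ℕ := fun e => toLex (tailKey e, d (h e))
  let σ := Tuple.sort key
  have hmono : Monotone (key ∘ σ) := Tuple.monotone_sort key
  have hlt : ∀ f i, key f < key (σ i) → σ.symm f < i := by
    intro f i hfi
    by_contra! hle
    have := hmono hle
    simp only [Function.comp_apply, Equiv.apply_symm_apply] at this
    exact absurd hfi this.not_gt
  have hroot : ∀ i : Fin r,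
      (treeGraph (t ∘ σ) (h ∘ σ) (Finset.univ.filter (· ≤ i))).Reachable (t (σ i)) o ∧
      (treeGraph (t ∘ σ) (h ∘ σ) (Finset.univ.filter (· ≤ i))).Reachable (h (σ i)) o := by
    intro i
    induction i using WellFoundedLT.induction with
    | _ i ih =>
    have hedge : (treeGraph (t ∘ σ) (h ∘ σ) (Finset.univ.filter (· ≤ i))).Reachable
        (t (σ i)) (h (σ i)) := reachable_of_mem (t := t ∘ σ) (h := h ∘ σ) (by simp)
    have hprev : ∀ f, key f < key (σ i) →
        (treeGraph (t ∘ σ) (h ∘ σ) (Finset.univ.filter (· ≤ i))).Reachable (t f) o ∧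
        (treeGraph (t ∘ σ) (h ∘ σ) (Finset.univ.filter (· ≤ i))).Reachable (h f) o := by
      intro f hf
      have hfi := hlt f i hf
      have hsub : Finset.univ.filter (· ≤ σ.symm f) ⊆ Finset.univ.filter (· ≤ i) := by
        intro e
        simp only [Finset.mem_filter, Finset.mem_univ, true_and]
        exact fun he => he.trans hfi.le
      have := ih _ hfi
      rw [Equiv.apply_symm_apply] at this
      exact ⟨reachable_mono hsub this.1, reachable_mono hsub this.2⟩
    by_cases hto : t (σ i) = o
    · rw [hto] at hedge ⊢
      exact ⟨SimpleGraph.Reachable.rfl, hedge.symm⟩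
    by_cases hd : d (h (σ i)) < d (t (σ i))
    · obtain ⟨f, ⟨hf, -⟩ | ⟨hf, hdf⟩⟩ :=
        exists_edge_dist_lt hc (o := o) (v := h (σ i)) (hth _ _).symm
      · exact absurd hf (hth _ _)
      · have hkey : key f < key (σ i) :=
          Prod.Lex.toLex_lt_toLex.2 (Or.inl (Prod.Lex.toLex_lt_toLex.2
            (Or.inl (hdf.trans hd))))
        have hho := hf ▸ (hprev f hkey).2
        exact ⟨hedge.trans hho, hho⟩
    · obtain ⟨f, ⟨hf, hdf⟩ | ⟨hf, -⟩⟩ := exists_edge_dist_lt hc (o := o) (v := t (σ i)) hto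
      · have htail : tailKey f = tailKey (σ i) := by simp only [tailKey, hf]
        have hkey : key f < key (σ i) :=
          Prod.Lex.toLex_lt_toLex.2 (Or.inr ⟨htail, lt_of_lt_of_le hdf (not_lt.1 hd)⟩)
        have hto' := hf ▸ (hprev f hkey).1
        exact ⟨hto', hedge.symm.trans hto'⟩
      · exact absurd hf.symm (hth _ _)
  refine ⟨σ, fun a => ?_, fun i a j hij hia haj => ?_⟩
  · have hreach : ∀ x, (∃ e, e ≤ a ∧ (t (σ e) = x ∨ h (σ e) = x)) →
        (treeGraph (t ∘ σ) (h ∘ σ) (Finset.univ.filter (· ≤ a))).Reachable x o := by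
      rintro x ⟨e, hea, hx⟩
      have hsub : Finset.univ.filter (· ≤ e) ⊆ Finset.univ.filter (· ≤ a) := by
        intro f
        simp only [Finset.mem_filter, Finset.mem_univ, true_and]
        exact fun hf => hf.trans hea
      rcases hx with rfl | rfl
      · exact reachable_mono hsub (hroot e).1
      · exact reachable_mono hsub (hroot e).2
    exact fun x y hx hy => (hreach x hx).trans (hreach y hy).symm
  · have hfst : Monotone fun i => tailKey (σ i) := fun _ _ hle =>
      Prod.Lex.monotone_fst _ _ (hmono hle)
    have hkij : tailKey (σ i) = tailKey (σ j) := by simp only [tailKey, hij]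
    have hka : tailKey (σ a) = tailKey (σ i) :=
      le_antisymm ((hfst haj).trans hkij.ge) (hfst hia)
    exact congrArg (fun p => (ofLex p).2) hka

end treeGraph

namespace LabeledTree

variable {kk ll : Finset ℕ} {β r : ℕ}

lemma biUnion_univ_comp_perm {ι α : Type*} [Fintype ι] [DecidableEq α] (w : Equiv.Perm ι)
    (f : ι → Finset α) :
    (Finset.univ.biUnion fun i => f (w i)) = Finset.univ.biUnion f := by
  ext z
  simp only [Finset.mem_biUnion, Finset.mem_univ, true_and]
  exact (w.surjective.exists (p := fun i => z ∈ f i)).symm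

/-- Relabel the edge `σ i` as `i` and the vertex `v` as `w v`, where `w` restores the
compatibility of the vertex order with the new edge order. -/
def relabel (T : LabeledTree kk ll β r) (σ : Equiv.Perm (Fin r)) (w : Equiv.Perm (Fin (r + 1)))
    (hw : ∀ (a : Fin r) (x y : Fin (r + 1)),
      (treeGraph (T.tail ∘ σ) (T.head ∘ σ) (Finset.univ.filter (· < a))).Reachable
        (T.tail (σ a)) x →
      (treeGraph (T.tail ∘ σ) (T.head ∘ σ) (Finset.univ.filter (· < a))).Reachable
        (T.head (σ a)) y → w x < w y) :
    LabeledTree kk ll β r where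
  kv i := (T.kv (w⁻¹ i)).image (Sum.map id ⇑σ⁻¹)
  lv i := T.lv (w⁻¹ i)
  bv i := T.bv (w⁻¹ i)
  sv i := (T.sv (w⁻¹ i)).image ⇑σ⁻¹
  head := w ∘ T.head ∘ σ
  tail := w ∘ T.tail ∘ σ
  mem_head e i := by
    simp only [Finset.mem_image, Sum.exists, Sum.map_inl, Sum.map_inr, reduceCtorEq, and_false,
      exists_false, false_or, Sum.inr.injEq, Equiv.Perm.inv_eq_iff_eq, Function.comp_apply]
    rw [exists_eq_right, T.mem_head, Equiv.Perm.eq_inv_iff_eq]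
  mem_tail e i := by
    simp only [Finset.mem_image, Equiv.Perm.inv_eq_iff_eq, Function.comp_apply]
    rw [exists_eq_right, T.mem_tail, Equiv.Perm.eq_inv_iff_eq]
  sturdy i := by
    rw [Finset.card_image_of_injective _ (Function.injective_id.sumMap σ⁻¹.injective)]
    exact T.sturdy _
  orient i := by
    rw [Finset.card_image_of_injective _ (Function.injective_id.sumMap σ⁻¹.injective)]
    exact T.orient _
  kv_disjoint i j hij :=
    (Finset.disjoint_image (Function.injective_id.sumMap σ⁻¹.injective)).2
      (T.kv_disjoint _ _ (w⁻¹.injective.ne hij))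
  kv_union := by
    have hT := congrArg (Finset.image (Sum.map id ⇑σ⁻¹)) T.kv_union
    rw [Finset.biUnion_image, Finset.image_union, Finset.image_image, Finset.image_image] at hT
    refine (biUnion_univ_comp_perm w⁻¹ fun i => (T.kv i).image _).trans (hT.trans ?_)
    congr 1
    ext z
    simp only [Finset.mem_image, Finset.mem_univ, true_and, Function.comp_apply, Sum.map_inr]
    exact (σ⁻¹.surjective.exists (p := fun e => Sum.inr e = z)).symm
  lv_disjoint i j hij := T.lv_disjoint _ _ (w⁻¹.injective.ne hij)
  lv_union := (biUnion_univ_comp_perm w⁻¹ T.lv).trans T.lv_union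
  sv_disjoint i j hij :=
    (Finset.disjoint_image σ⁻¹.injective).2 (T.sv_disjoint _ _ (w⁻¹.injective.ne hij))
  sv_union := by
    refine (biUnion_univ_comp_perm w⁻¹ fun i => (T.sv i).image _).trans ?_
    rw [← Finset.biUnion_image, T.sv_union]
    exact Finset.image_univ_of_surjective σ⁻¹.surjective
  bv_sum := (Equiv.sum_comp w⁻¹ T.bv).trans T.bv_sum
  connected := by
    refine treeGraph.connected_equiv_comp w ?_
    rw [treeGraph.comp_perm_univ]
    exact T.connected
  cond_c a x y hx hy := by
    have := hw a (w.symm x) (w.symm y) (by simpa using treeGraph.reachable_comp_equiv w hx)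
      (by simpa using treeGraph.reachable_comp_equiv w hy)
    simpa using this

/-- In an odd-even tree no vertex is both a tail and a head. -/
lemma tail_ne_head_of_isOddEven {T : LabeledTree kk ll β r} (hT : IsOddEven T) (e f : Fin r) :
    T.tail e ≠ T.head f := by
  intro hef
  have htail : e ∈ T.sv (T.tail e) := (T.mem_tail _ _).2 rfl
  have hhead : Sum.inr f ∈ T.kv (T.tail e) := (T.mem_head _ _).2 hef.symm
  rcases Nat.even_or_odd (T.bv (T.tail e)) with hb | hb
  · simp [(hT _).1 hb] at htail
  · simp [(hT _).2 hb] at hhead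

end LabeledTree

/-!
Statement 0 (Proposition "sorted is good", part (a)): for every odd-even
`(𝔟, r)`-labeled tree `𝒯` there is a permutation `τ ∈ Sym(r)` such that the relabeled
tree `τ.𝒯` is sorted.  The action of `τ` relabels the edges `e_i ↦ e_{τ(i)}`, replaces
the markings `★′_i, ★″_i` by `★′_{τ(i)}, ★″_{τ(i)}` in all vertex data, and then
relabels the vertices by the unique permutation `w` restoring condition (c); this is
expressed below by exhibiting the resulting labeled tree `T'` together with `w`.
-/

theorem sorted_odd_even_relabeling_exists
    (kk ll : Finset ℕ) (β r : ℕ)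
    (hstable : 3 ≤ kk.card + 2 * ll.card + 3 * β)
    (horient : Odd (kk.card + β))
    (T : LabeledTree kk ll β r) (hT : IsOddEven T) :
    ∃ (τ : Equiv.Perm (Fin r)) (T' : LabeledTree kk ll β r)
      (w : Equiv.Perm (Fin (r + 1))),
      (∀ i, T'.kv i = (T.kv (w⁻¹ i)).image (Sum.map id ⇑τ)) ∧
      (∀ i, T'.lv i = T.lv (w⁻¹ i)) ∧
      (∀ i, T'.bv i = T.bv (w⁻¹ i)) ∧
      (∀ i, T'.sv i = (T.sv (w⁻¹ i)).image ⇑τ) ∧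
      IsOddEven T' ∧ IsSorted T' := by
  have hth := LabeledTree.tail_ne_head_of_isOddEven hT
  obtain ⟨σ, hconn, hint⟩ := treeGraph.exists_sorted_edge_order T.connected hth
  obtain ⟨w, hw⟩ := treeGraph.exists_vertex_relabeling
    ((treeGraph.comp_perm_univ (t := T.tail) (h := T.head) σ).symm ▸ T.connected)
  refine ⟨σ⁻¹, T.relabel σ w hw, w, fun _ => rfl, fun _ => rfl, fun _ => rfl, fun _ => rfl,
    fun i => ⟨fun hb => ?_, fun hb => ?_⟩, fun a x y hx hy => ?_, fun v i a j hi hj hia haj => ?_⟩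
  · exact Finset.image_eq_empty.2 ((hT _).1 hb)
  · exact Finset.image_eq_empty.2 ((hT _).2 hb)
  · have hmem : ∀ z, (∃ e, e ≤ a ∧ ((T.relabel σ w hw).tail e = z ∨
        (T.relabel σ w hw).head e = z)) →
        ∃ e, e ≤ a ∧ (T.tail (σ e) = w.symm z ∨ T.head (σ e) = w.symm z) := by
      rintro z ⟨e, hea, rfl | rfl⟩
      · exact ⟨e, hea, Or.inl (w.symm_apply_apply _).symm⟩
      · exact ⟨e, hea, Or.inr (w.symm_apply_apply _).symm⟩
    have := treeGraph.reachable_equiv_comp w (hconn a _ _ (hmem x hx) (hmem y hy))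
    rwa [w.apply_symm_apply, w.apply_symm_apply] at this
  · rw [LabeledTree.mem_tail] at hi hj ⊢
    subst hi
    exact congrArg w (hint i a j (w.injective hj.symm) hia haj)
end

section
/- Let 𝔟 = (𝗄, 𝗅, β) be a basic moduli specification with 𝗄 ⊂ ℕ and let r ≥ 0. If 𝒯 is a sorted odd-even (𝔟, r)-labeled tree and 1 ≤ i, j ≤ r+1 are indices with β_𝒯(v_i) odd and β_𝒯(v_j) even, then i < j. (Proposition "sorted is good", part (c).) -/
theorem treeGraph_adj {r : ℕ} {V : Type*} {tail head : Fin r → V} {E : Finset (Fin r)}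
    {x y : V} (h : (treeGraph tail head E).Adj x y) :
    ∃ e ∈ E, (tail e = x ∧ head e = y) ∨ (tail e = y ∧ head e = x) := by
  rw [treeGraph, SimpleGraph.fromRel_adj] at h
  obtain ⟨-, ⟨e, he, h⟩ | ⟨e, he, h⟩⟩ := h
  · exact ⟨e, he, Or.inl h⟩
  · exact ⟨e, he, Or.inr h⟩

/-- In `treeGraph`, a vertex joined to a different vertex is an endpoint of an edge. -/
theorem exists_edge_of_reachable {r : ℕ} {V : Type*} {tail head : Fin r → V}
    {E : Finset (Fin r)} {x y : V} (h : (treeGraph tail head E).Reachable x y) (hne : x ≠ y) :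
    ∃ e ∈ E, tail e = x ∨ head e = x := by
  obtain ⟨w⟩ := h
  cases w with
  | nil => exact absurd rfl hne
  | cons hadj _ =>
    obtain ⟨e, he, h | h⟩ := treeGraph_adj hadj
    · exact ⟨e, he, Or.inl h.1⟩
    · exact ⟨e, he, Or.inr h.2⟩

/-- A path through the edges up to `m` either avoids `m` or reaches an endpoint of `m` through
earlier edges. -/
theorem reachable_lt_or_reachable_endpoint {r : ℕ} {V : Type*} {tail head : Fin r → V}
    {m : Fin r} {x y : V}
    (h : (treeGraph tail head (Finset.univ.filter (fun e => e ≤ m))).Reachable x y) :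
    (treeGraph tail head (Finset.univ.filter (fun e => e < m))).Reachable x y ∨
    (treeGraph tail head (Finset.univ.filter (fun e => e < m))).Reachable x (tail m) ∨
    (treeGraph tail head (Finset.univ.filter (fun e => e < m))).Reachable x (head m) := by
  obtain ⟨w⟩ := h
  induction w with
  | nil => exact Or.inl (SimpleGraph.Reachable.refl _)
  | @cons u v _ hadj _ ih =>
    obtain ⟨e, he, h⟩ := treeGraph_adj hadj
    rcases (Finset.mem_filter.mp he).2.eq_or_lt with rfl | hlt
    · rcases h with ⟨h, -⟩ | ⟨-, h⟩
      · exact Or.inr (Or.inl (h ▸ SimpleGraph.Reachable.refl _))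
      · exact Or.inr (Or.inr (h ▸ SimpleGraph.Reachable.refl _))
    · have huv : (treeGraph tail head (Finset.univ.filter (fun e => e < m))).Reachable u v := by
        refine SimpleGraph.Adj.reachable ?_
        rw [treeGraph, SimpleGraph.fromRel_adj]
        have hmem : e ∈ Finset.univ.filter (fun e => e < m) := by simpa using hlt
        exact ⟨hadj.ne, h.imp (fun h => ⟨e, hmem, h⟩) (fun h => ⟨e, hmem, h⟩)⟩
      exact ih.imp huv.trans (Or.imp huv.trans huv.trans)

namespace LabeledTree

variable {kk ll : Finset ℕ} {β r : ℕ} {T : LabeledTree kk ll β r}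

theorem odd_bv_tail (hoe : IsOddEven T) (e : Fin r) : Odd (T.bv (T.tail e)) := by
  by_contra h
  have hmem := (T.mem_tail e _).mpr rfl
  rw [(hoe _).1 (Nat.not_odd_iff_even.mp h)] at hmem
  exact absurd hmem (Finset.notMem_empty _)

theorem even_bv_head (hoe : IsOddEven T) (e : Fin r) : Even (T.bv (T.head e)) := by
  by_contra h
  have hmem := (T.mem_head e _).mpr rfl
  rw [(hoe _).2 (Nat.not_even_iff_odd.mp h)] at hmem
  exact absurd hmem (Finset.notMem_empty _)

theorem tail_ne_head (hoe : IsOddEven T) (e f : Fin r) : T.tail e ≠ T.head f := fun h =>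
  Nat.not_even_iff_odd.mpr (odd_bv_tail hoe e) (h ▸ even_bv_head hoe f)

/-- In a sorted odd-even tree, every tail precedes every head. -/
theorem tail_lt_head (hoe : IsOddEven T) (hs : IsSorted T) (e f : Fin r) :
    T.tail e < T.head f := by
  suffices H : ∀ m e f : Fin r, e ≤ m → f ≤ m → T.tail e < T.head f from
    H (max e f) e f (le_max_left _ _) (le_max_right _ _)
  intro m
  induction m using WellFoundedLT.induction with
  | ind m ih =>
    intro e f he hf
    rcases he.eq_or_lt with rfl | he' <;> rcases hf.eq_or_lt with hfe | hf'
    · subst hfe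
      exact T.cond_c _ _ _ (.refl _) (.refl _)
    · have hconn := hs.1 e (T.head f) (T.tail e) ⟨f, hf, Or.inr rfl⟩ ⟨e, le_rfl, Or.inl rfl⟩
      have hcases : (treeGraph T.tail T.head (Finset.univ.filter (fun a => a < e))).Reachable
            (T.head f) (T.tail e) ∨
          (treeGraph T.tail T.head (Finset.univ.filter (fun a => a < e))).Reachable
            (T.head f) (T.head e) := by
        have := reachable_lt_or_reachable_endpoint hconn
        tauto
      rcases hcases with h | h
      · obtain ⟨a, ha, hta | hha⟩ := exists_edge_of_reachable h.symm (tail_ne_head hoe e f)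
        · have hae : a < e := (Finset.mem_filter.mp ha).2
          rw [← hta]
          exact ih (max a f) (max_lt hae hf') a f (le_max_left _ _) (le_max_right _ _)
        · exact absurd hha.symm (tail_ne_head hoe e a)
      · exact T.cond_c e _ _ (.refl _) h.symm
    · subst hfe
      have hconn := hs.1 f (T.tail e) (T.head f) ⟨e, he, Or.inl rfl⟩ ⟨f, le_rfl, Or.inr rfl⟩
      have hcases : (treeGraph T.tail T.head (Finset.univ.filter (fun a => a < f))).Reachable
            (T.tail e) (T.tail f) ∨
          (treeGraph T.tail T.head (Finset.univ.filter (fun a => a < f))).Reachable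
            (T.tail e) (T.head f) := by
        have := reachable_lt_or_reachable_endpoint hconn
        tauto
      rcases hcases with h | h
      · exact T.cond_c f _ _ h.symm (.refl _)
      · obtain ⟨a, ha, hta | hha⟩ := exists_edge_of_reachable h.symm (tail_ne_head hoe e f).symm
        · exact absurd hta (tail_ne_head hoe a f)
        · have haf : a < f := (Finset.mem_filter.mp ha).2
          rw [← hha]
          exact ih (max e a) (max_lt he' haf) e a (le_max_left _ _) (le_max_right _ _)
    · exact ih (max e f) (max_lt he' hf') e f (le_max_left _ _) (le_max_right _ _)

end LabeledTree

/-!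
Statement 1 (Proposition "sorted is good", part (c)): in a sorted odd-even
`(𝔟, r)`-labeled tree, every vertex of odd degree precedes every vertex of even degree.
-/

theorem sorted_odd_even_odd_before_even
    (kk ll : Finset ℕ) (β r : ℕ)
    (hstable : 3 ≤ kk.card + 2 * ll.card + 3 * β)
    (horient : Odd (kk.card + β))
    (T : LabeledTree kk ll β r)
    (hoe : IsOddEven T) (hs : IsSorted T)
    (i j : Fin (r + 1))
    (hi : Odd (T.bv i)) (hj : Even (T.bv j)) :
    i < j := by
  have hne : i ≠ j := by
    rintro rfl
    exact Nat.not_even_iff_odd.mpr hi hj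
  have hij := T.connected.preconnected i j
  obtain ⟨e, -, he | he⟩ := exists_edge_of_reachable hij hne
  · obtain ⟨f, -, hf | hf⟩ := exists_edge_of_reachable hij.symm hne.symm
    · exact absurd hj (Nat.not_even_iff_odd.mpr (hf ▸ LabeledTree.odd_bv_tail hoe f))
    · exact he ▸ hf ▸ LabeledTree.tail_lt_head hoe hs e f
  · exact absurd (he ▸ LabeledTree.even_bv_head hoe e) (Nat.not_even_iff_odd.mpr hi)
end

section
/- With all rings regarded as subrings of the field of formal Laurent series over K = Frac(ℝ[α₀, …, α_{2m}]) in the variable ℏ⁻¹, one has the equality M⁻¹A[ℏ] = S⁻¹M⁻¹A[ℏ] ∩ A[ℏ][[ℏ⁻¹]]. Equivalently: if C ∈ A[ℏ][[ℏ⁻¹]] and there exists q ∈ M such that qC lies in S⁻¹A[ℏ], then C ∈ M⁻¹A[ℏ]. (This is the key reduction in the lemma asserting that the constraint correlators Z_a^ℂ(ℏ) lie in R_rat^ℂ rather than merely in S⁻¹R_rat^ℂ.) -/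
/-!
Statement 4: `M⁻¹A[ℏ] = S⁻¹M⁻¹A[ℏ] ∩ A[ℏ][[ℏ⁻¹]]` inside the field of formal Laurent
series over `K = Frac(A)` in the variable `ℏ⁻¹`, where `A = ℝ[α₀, …, α_{2m}]`,
`S ⊂ A` is the multiplicative set of nonzero homogeneous polynomials and `M ⊂ A[ℏ]` is
the multiplicative set generated by `ℏ` and `ℏ + (αᵢ − αⱼ)/n` for `i ≠ j`, `n ≥ 1`.

Equivalently (as formalized below): if `C ∈ A[ℏ][[ℏ⁻¹]]` and there exists `q ∈ M`
with `q·C ∈ S⁻¹A[ℏ]`, then `C ∈ M⁻¹A[ℏ]`.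

We work in `L = LaurentSeries K = HahnSeries ℤ K`, the formal Laurent series field in
the variable `t = ℏ⁻¹`; thus `ℏ` is `t⁻¹`, and `A[ℏ][[ℏ⁻¹]]` consists of the elements
all of whose coefficients lie in (the image of) `A` (the finiteness of the positive
`ℏ`-powers being automatic in `HahnSeries ℤ K`).
-/

noncomputable section

abbrev A (m : ℕ) : Type := MvPolynomial (Fin (2 * m + 1)) ℝ
abbrev K (m : ℕ) : Type := FractionRing (A m)
abbrev L (m : ℕ) : Type := LaurentSeries (K m)

/-- The constants embedding `A → L`. -/
def constL (m : ℕ) : A m →+* L m :=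
  (HahnSeries.C : K m →+* L m).comp (algebraMap (A m) (K m))

/-- The variable `t = ℏ⁻¹` of the Laurent series field. -/
def tvar (m : ℕ) : L m := HahnSeries.single (1 : ℤ) (1 : K m)

/-- `ℏ = t⁻¹`. -/
def hbar (m : ℕ) : L m := (tvar m)⁻¹

/-- The `ℏ⁻¹`-expansion embedding `A[ℏ] → L`, sending `ℏ` to `t⁻¹`. -/
def polyL (m : ℕ) (f : Polynomial (A m)) : L m :=
  Polynomial.eval₂ (constL m) (hbar m) f

/-- Membership in the multiplicative set `S` of nonzero homogeneous polynomials. -/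
def MemS (m : ℕ) (s : A m) : Prop :=
  s ≠ 0 ∧ ∃ n : ℕ, MvPolynomial.IsHomogeneous s n

/-- The generators of the multiplicative set `M`: `ℏ` and `ℏ + (αᵢ − αⱼ)/n` for all
`i ≠ j` and integers `n ≥ 1`, viewed inside `L`. -/
def genM (m : ℕ) : Set (L m) :=
  {hbar m} ∪
    {x | ∃ i j : Fin (2 * m + 1), i ≠ j ∧ ∃ n : ℕ, 0 < n ∧
      x = hbar m + constL m (MvPolynomial.X i - MvPolynomial.X j) / (n : L m)}

/-- The coefficients of `x` lie in `A`, i.e. `x ∈ A[ℏ][[ℏ⁻¹]]`. -/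
def HasIntegralCoeffs (m : ℕ) (x : L m) : Prop :=
  ∀ n : ℤ, ∃ a : A m, algebraMap (A m) (K m) a = x.coeff n

theorem hbar_eq_single (m : ℕ) : hbar m = HahnSeries.single (-1 : ℤ) (1 : K m) := by
  rw [hbar, tvar, HahnSeries.inv_single, inv_one]

theorem constL_eq_single (m : ℕ) (a : A m) :
    constL m a = HahnSeries.single (0 : ℤ) (algebraMap (A m) (K m) a) := rfl

theorem HasIntegralCoeffs.single_mul {m : ℕ} {x : L m} (hx : HasIntegralCoeffs m x) (k : ℤ)
    (a : A m) :
    HasIntegralCoeffs m (HahnSeries.single k (algebraMap (A m) (K m) a) * x) := by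
  intro n
  obtain ⟨b, hb⟩ := hx (n - k)
  refine ⟨a * b, ?_⟩
  rw [HahnSeries.coeff_single_mul, map_mul, hb]

theorem HasIntegralCoeffs.hbar_mul {m : ℕ} {x : L m} (hx : HasIntegralCoeffs m x) :
    HasIntegralCoeffs m (hbar m * x) := by
  simpa only [hbar_eq_single, map_one] using hx.single_mul (-1) 1

theorem HasIntegralCoeffs.constL_mul {m : ℕ} {x : L m} (hx : HasIntegralCoeffs m x) (a : A m) :
    HasIntegralCoeffs m (constL m a * x) :=
  hx.single_mul 0 a

theorem HasIntegralCoeffs.add {m : ℕ} {x y : L m} (hx : HasIntegralCoeffs m x)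
    (hy : HasIntegralCoeffs m y) : HasIntegralCoeffs m (x + y) := by
  intro n
  obtain ⟨a, ha⟩ := hx n
  obtain ⟨b, hb⟩ := hy n
  exact ⟨a + b, by rw [map_add, ha, hb, HahnSeries.coeff_add]⟩

theorem constL_div_natCast (m : ℕ) (a : A m) {n : ℕ} (hn : 0 < n) :
    constL m a / (n : L m) = constL m (MvPolynomial.C ((n : ℝ)⁻¹) * a) := by
  have hnr : (n : ℝ) ≠ 0 := Nat.cast_ne_zero.mpr hn.ne'
  have hunit : (n : L m) * constL m (MvPolynomial.C ((n : ℝ)⁻¹)) = 1 := by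
    rw [← map_natCast (constL m), ← map_mul, ← map_natCast (MvPolynomial.C (σ := Fin (2 * m + 1))),
      ← map_mul, mul_inv_cancel₀ hnr, map_one, map_one]
  rw [div_eq_iff (left_ne_zero_of_mul_eq_one hunit), map_mul]
  linear_combination -constL m a * hunit

theorem HasIntegralCoeffs.mul_of_mem_closure {m : ℕ} {q x : L m}
    (hq : q ∈ Submonoid.closure (genM m)) (hx : HasIntegralCoeffs m x) :
    HasIntegralCoeffs m (q * x) := by
  induction hq using Submonoid.closure_induction generalizing x with
  | mem q hq =>
    rcases hq with rfl | ⟨i, j, -, n, hn, rfl⟩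
    · exact hx.hbar_mul
    · rw [constL_div_natCast m _ hn, add_mul]
      exact hx.hbar_mul.add (hx.constL_mul _)
  | one => rwa [one_mul]
  | mul p q _ _ ihp ihq =>
    rw [mul_assoc]
    exact ihp (ihq hx)

theorem polyL_coeff (m : ℕ) (f : Polynomial (A m)) (k : ℕ) :
    (polyL m f).coeff (-(k : ℤ)) = algebraMap (A m) (K m) (f.coeff k) := by
  induction f using Polynomial.induction_on' with
  | add p q hp hq =>
    rw [polyL] at hp hq
    rw [polyL, Polynomial.eval₂_add, HahnSeries.coeff_add, hp, hq, Polynomial.coeff_add, map_add]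
  | monomial n a =>
    rw [polyL, Polynomial.eval₂_monomial, hbar_eq_single, constL_eq_single,
      HahnSeries.single_pow, HahnSeries.single_mul_single, HahnSeries.coeff_single,
      Polynomial.coeff_monomial]
    by_cases h : n = k
    · simp [h]
    · have h' : ¬ k = n := fun e => h e.symm
      simp [h, h']

theorem correlator_integrality_ring_identity
    (m : ℕ) (hm : 1 ≤ m) (C : L m)
    -- `C ∈ A[ℏ][[ℏ⁻¹]]`: every coefficient of `C` lies in `A`
    (hcoeffs : ∀ n : ℤ, ∃ a : A m, algebraMap (A m) (K m) a = C.coeff n)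
    -- `q·C ∈ S⁻¹A[ℏ]` for some `q ∈ M`
    (hq : ∃ q ∈ Submonoid.closure (genM m), ∃ (s : A m) (f : Polynomial (A m)),
        MemS m s ∧ q * C * constL m s = polyL m f) :
    -- then `C ∈ M⁻¹A[ℏ]`
    ∃ q ∈ Submonoid.closure (genM m), ∃ f : Polynomial (A m),
      q * C = polyL m f := by
  obtain ⟨q, hqM, s, f, ⟨hs, -⟩, hf⟩ := hq
  refine ⟨q, hqM, ?_⟩
  have hint : HasIntegralCoeffs m (q * C) := HasIntegralCoeffs.mul_of_mem_closure hqM hcoeffs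
  have hinj : Function.Injective (algebraMap (A m) (K m)) := IsFractionRing.injective _ _
  have hdvd : Polynomial.C s ∣ f := by
    rw [Polynomial.C_dvd_iff_dvd_coeff]
    intro k
    obtain ⟨a, ha⟩ := hint (-(k : ℤ))
    refine ⟨a, hinj ?_⟩
    rw [← polyL_coeff, ← hf, mul_comm (q * C), constL_eq_single, HahnSeries.coeff_single_mul, sub_zero,
      map_mul, ha]
  obtain ⟨g, rfl⟩ := hdvd
  have hs' : constL m s ≠ 0 := by
    rw [constL_eq_single]
    exact HahnSeries.single_ne_zero ((map_ne_zero_iff _ hinj).mpr hs)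
  refine ⟨g, mul_right_cancel₀ hs' ?_⟩
  rw [hf, polyL, polyL, Polynomial.eval₂_mul, Polynomial.eval₂_C, mul_comm]

end
end

section
/- In the field ℝ(λ₁, …, λ_m) of rational functions, the identity 0 = Σ_{a=1}^{2m} (∏_{b=1}^{2m} α_b) / ( α_a² · ∏_{a′ ∈ {1,…,2m}, a′ ≠ a} ( (α_a − α_{a′}) · (−α_{a′}) ) ) + (−1)^{m+1} · ( Σ_{a=1}^{2m} ( 1 / ∏_{a′ ∈ {0,…,2m} \ {a, 2m+1−a}} (−α_{a′} − α_a) ) · ( −(λ₁⋯λ_m) / (2 α_a) ) )² holds, where α₀ = 0, α_i = λ_i and α_{2m+1−i} = −λ_i for 1 ≤ i ≤ m. -/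
/-- Partial fractions of `1 / ∏ (z - y i)` evaluated at `z = 0`. -/
theorem sum_inv_mul_prod_sub {ι K : Type*} [Fintype ι] [DecidableEq ι] [Nonempty ι] [Field K]
    (y : ι → K) (hy : Function.Injective y) (hy0 : ∀ i, y i ≠ 0) :
    ∑ i, (y i * ∏ j ∈ Finset.univ.erase i, (y i - y j))⁻¹ =
      (-1) ^ (Fintype.card ι + 1) / ∏ i, y i := by
  have h := Lagrange.eval_interpolate_not_at_node (s := Finset.univ) (v := y)
    (x := 0) (fun _ => 1) (fun i _ => (hy0 i).symm)
  have h1 := Lagrange.interpolate_one (s := Finset.univ) (v := y) hy.injOn Finset.univ_nonempty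
  have h2 : Lagrange.interpolate Finset.univ y (fun _ => (1 : K)) = 1 := h1
  have hp : ∏ i, y i ≠ 0 := Finset.prod_ne_zero_iff.mpr fun i _ => hy0 i
  rw [h2, Lagrange.eval_nodal] at h
  simp only [Polynomial.eval_one, zero_sub, mul_one, Finset.prod_neg, inv_neg, mul_neg,
    Finset.sum_neg_distrib, Finset.card_univ, Lagrange.nodalWeight, Finset.prod_inv_distrib] at h
  simp only [mul_inv, mul_comm (y _)⁻¹]
  rw [eq_div_iff hp, pow_succ]
  have hs : ((-1 : K) ^ Fintype.card ι) * (-1) ^ Fintype.card ι = 1 := by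
    rw [← mul_pow]; simp
  linear_combination ((-1 : K) ^ Fintype.card ι) * h - (∑ i,
    (∏ j ∈ Finset.univ.erase i, (y i - y j))⁻¹ * (y i)⁻¹) * (∏ i, y i) * hs

/-- Pair the index `b` with `2 * m + 1 - b`. -/
@[to_additive]
theorem prod_Icc_eq_prod_pairs {M : Type*} [CommMonoid M] (m : ℕ) (f : ℕ → M) :
    ∏ b ∈ Finset.Icc 1 (2 * m), f b = ∏ i : Fin m, f (i + 1) * f (2 * m - i) := by
  rw [Finset.prod_mul_distrib, Fin.prod_univ_eq_prod_range (fun i => f (i + 1)),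
    Fin.prod_univ_eq_prod_range (fun i => f (2 * m - i))]
  have hunion : Finset.Icc 1 (2 * m) = Finset.Icc 1 m ∪ Finset.Icc (m + 1) (2 * m) := by
    ext; simp; omega
  rw [hunion, Finset.prod_union]
  · congr 1
    · exact (Finset.prod_nbij' (fun i => i + 1) (fun i => i - 1) (by simp)
        (by simp; omega) (by simp) (by simp; omega) (by simp)).symm
    · exact (Finset.prod_nbij' (fun i => 2 * m - i) (fun i => 2 * m - i) (by simp; omega)
        (by simp; omega) (by simp; omega) (by simp; omega) (by simp)).symm
  · rw [Finset.disjoint_left]; simp; omega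

theorem filter_Icc_zero_ne_pair_left (m : ℕ) (i : Fin m) :
    (Finset.Icc 0 (2 * m)).filter (fun x => x ≠ (i : ℕ) + 1 ∧ x ≠ 2 * m + 1 - ((i : ℕ) + 1)) =
      insert 0 ((Finset.Icc 1 (2 * m)).filter fun x => x ≠ (i : ℕ) + 1 ∧ x ≠ 2 * m - i) := by
  ext; simp; omega

theorem filter_Icc_zero_ne_pair_right (m : ℕ) (i : Fin m) :
    (Finset.Icc 0 (2 * m)).filter (fun x => x ≠ 2 * m - (i : ℕ) ∧
        x ≠ 2 * m + 1 - (2 * m - (i : ℕ))) =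
      insert 0 ((Finset.Icc 1 (2 * m)).filter fun x => x ≠ (i : ℕ) + 1 ∧ x ≠ 2 * m - i) := by
  ext; simp; omega

theorem prod_filter_ne_pair {M : Type*} [CommMonoid M] (m : ℕ) (i : Fin m) (f : ℕ → M) :
    ∏ b ∈ (Finset.Icc 1 (2 * m)).filter (fun x => x ≠ (i : ℕ) + 1 ∧ x ≠ 2 * m - i), f b =
      ∏ j ∈ Finset.univ.erase i, f (j + 1) * f (2 * m - j) := by
  rw [Finset.prod_filter, prod_Icc_eq_prod_pairs, ← Finset.mul_prod_erase _ _
    (Finset.mem_univ i)]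
  have h : (i : ℕ) < m := i.2
  simp only [ne_eq, not_true, false_and, and_false, if_false, mul_one, one_mul]
  refine Finset.prod_congr rfl fun j hj => ?_
  have hji : (j : ℕ) ≠ i := fun h => Finset.ne_of_mem_erase hj (Fin.ext h)
  rw [if_pos (by omega), if_pos (by omega)]

section Contributions

variable {K : Type*} [Field K] {m : ℕ} {l : Fin m → K} {α : ℕ → K}

/-- The two factors of the pair of `j` combine to `l i ^ 2 - l j ^ 2`. -/
theorem prod_filter_neg_sub (hα0 : α 0 = 0) (hα1 : ∀ i : Fin m, α (i + 1) = l i)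
    (hα2 : ∀ i : Fin m, α (2 * m - i) = -l i) (i : Fin m) (x : K) (hx : x ^ 2 = l i ^ 2) :
    ∏ b ∈ insert 0 ((Finset.Icc 1 (2 * m)).filter
        fun x => x ≠ (i : ℕ) + 1 ∧ x ≠ 2 * m - i), (-α b - x) =
      -x * ∏ j ∈ Finset.univ.erase i, (l i ^ 2 - l j ^ 2) := by
  rw [Finset.prod_insert (by simp), prod_filter_ne_pair, hα0]
  congr 1
  · ring
  · refine Finset.prod_congr rfl fun j _ => ?_
    rw [hα1, hα2]
    linear_combination hx

theorem prod_filter_ne_sub_mul_neg (hα1 : ∀ i : Fin m, α (i + 1) = l i)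
    (hα2 : ∀ i : Fin m, α (2 * m - i) = -l i) (i : Fin m) (a : ℕ)
    (ha : a = i + 1 ∨ a = 2 * m - i) :
    ∏ b ∈ (Finset.Icc 1 (2 * m)).filter (fun x => x ≠ a), ((α a - α b) * (-α b)) =
      2 * α a ^ 2 * ∏ j ∈ Finset.univ.erase i, ((l i ^ 2 - l j ^ 2) * (-l j ^ 2)) := by
  have him : (i : ℕ) < m := i.2
  have hs : (Finset.Icc 1 (2 * m)).filter (fun x => x ≠ a) = insert (2 * m + 1 - a)
      ((Finset.Icc 1 (2 * m)).filter fun x => x ≠ (i : ℕ) + 1 ∧ x ≠ 2 * m - i) := by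
    ext; simp; omega
  have hneg : α (2 * m + 1 - a) = -α a := by
    rcases ha with rfl | rfl
    · rw [hα1, ← hα2]; congr 1; omega
    · rw [hα2, neg_neg, ← hα1]; congr 1; omega
  have hsq : α a ^ 2 = l i ^ 2 := by
    rcases ha with rfl | rfl
    · rw [hα1]
    · rw [hα2, neg_sq]
  rw [hs, Finset.prod_insert (by simp; omega), prod_filter_ne_pair, hneg]
  congr 1
  · ring
  · refine Finset.prod_congr rfl fun j _ => ?_
    rw [hα1, hα2]
    linear_combination (-l j ^ 2) * hsq

theorem degree_two_vertex_contribution [NeZero (2 : K)] (hl : ∀ i, l i ≠ 0)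
    (hα1 : ∀ i : Fin m, α (i + 1) = l i) (hα2 : ∀ i : Fin m, α (2 * m - i) = -l i) :
    ∑ a ∈ Finset.Icc 1 (2 * m), (∏ b ∈ Finset.Icc 1 (2 * m), α b) /
        (α a ^ 2 * ∏ a' ∈ (Finset.Icc 1 (2 * m)).filter (fun x => x ≠ a),
          ((α a - α a') * (-α a'))) =
      -∑ i, (l i ^ 2 * ∏ j ∈ Finset.univ.erase i, (l i ^ 2 - l j ^ 2))⁻¹ := by
  rw [sum_Icc_eq_sum_pairs, ← Finset.sum_neg_distrib]
  refine Finset.sum_congr rfl fun i _ => ?_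
  have h2 : (2 : K) ≠ 0 := two_ne_zero
  have hli := hl i
  have hp : ∏ j ∈ Finset.univ.erase i, (-l j ^ 2) ≠ 0 :=
    Finset.prod_ne_zero_iff.mpr fun j _ => neg_ne_zero.mpr (pow_ne_zero 2 (hl j))
  rw [prod_filter_ne_sub_mul_neg hα1 hα2 i _ (Or.inl rfl),
    prod_filter_ne_sub_mul_neg hα1 hα2 i _ (Or.inr rfl), prod_Icc_eq_prod_pairs]
  simp only [hα1, hα2, Finset.prod_mul_distrib]
  rw [← Finset.prod_mul_distrib, ← Finset.mul_prod_erase _ _ (Finset.mem_univ i)]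
  have hc : ∀ j, l j * -l j = -l j ^ 2 := fun j => by ring
  simp only [hc]
  generalize ∏ j ∈ Finset.univ.erase i, (-l j ^ 2) = p at hp ⊢
  generalize ∏ j ∈ Finset.univ.erase i, (l i ^ 2 - l j ^ 2) = q
  rcases eq_or_ne q 0 with rfl | hq
  · simp
  · field_simp
    ring

theorem chain_edge_contribution [NeZero (2 : K)] (hα0 : α 0 = 0)
    (hα1 : ∀ i : Fin m, α (i + 1) = l i) (hα2 : ∀ i : Fin m, α (2 * m - i) = -l i)
    (P : K) :
    ∑ a ∈ Finset.Icc 1 (2 * m), (1 / ∏ a' ∈ (Finset.Icc 0 (2 * m)).filter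
        (fun x => x ≠ a ∧ x ≠ 2 * m + 1 - a), (-α a' - α a)) * (-(P / (2 * α a))) =
      P * ∑ i, (l i ^ 2 * ∏ j ∈ Finset.univ.erase i, (l i ^ 2 - l j ^ 2))⁻¹ := by
  rw [sum_Icc_eq_sum_pairs, Finset.mul_sum]
  refine Finset.sum_congr rfl fun i _ => ?_
  have h2 : (2 : K) ≠ 0 := two_ne_zero
  rw [filter_Icc_zero_ne_pair_left, filter_Icc_zero_ne_pair_right, hα1, hα2, prod_filter_neg_sub hα0 hα1 hα2 i _ rfl,
    prod_filter_neg_sub hα0 hα1 hα2 i _ (neg_sq _)]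
  field_simp
  ring

end Contributions

theorem MvPolynomial.X_sq_injective (σ R : Type*) [CommSemiring R] [Nontrivial R] :
    Function.Injective fun i : σ => (MvPolynomial.X i : MvPolynomial σ R) ^ 2 := by
  intro i j h
  simp only [MvPolynomial.X_pow_eq_monomial] at h
  rw [MvPolynomial.monomial_left_inj one_ne_zero] at h
  exact Finsupp.single_left_injective two_ne_zero h


/-!
Statement 6: the fixed-point identity expressing the vanishing of the equivariant open
Gromov–Witten invariant `I_m(1, ∅, 2)` of `ℝP^{2m} ⊂ ℂP^{2m}`.  We work in the field
`ℝ(λ₁, …, λ_m)` of rational functions, realized as the fraction field of the polynomial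
ring `ℝ[λ₁, …, λ_m]`, with `λ_i` the image of the `i`-th variable, and with
`α₀ = 0`, `α_i = λ_i`, `α_{2m+1−i} = −λ_i` for `1 ≤ i ≤ m` (so `α (i.val + 1) = λ_i`
and `α (2m − i.val) = −λ_i` in the 0-based indexing of `Fin m`).
-/

theorem open_gw_degree_two_relation
    (m : ℕ) (hm : 1 ≤ m)
    (lam : Fin m → FractionRing (MvPolynomial (Fin m) ℝ))
    (hlam : ∀ i : Fin m,
      lam i = algebraMap (MvPolynomial (Fin m) ℝ)
        (FractionRing (MvPolynomial (Fin m) ℝ)) (MvPolynomial.X i))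
    (α : ℕ → FractionRing (MvPolynomial (Fin m) ℝ))
    (hα0 : α 0 = 0)
    (hα1 : ∀ i : Fin m, α (i.val + 1) = lam i)
    (hα2 : ∀ i : Fin m, α (2 * m - i.val) = - lam i) :
    0 = (∑ a ∈ Finset.Icc 1 (2 * m),
          (∏ b ∈ Finset.Icc 1 (2 * m), α b) /
            (α a ^ 2 *
              ∏ a' ∈ (Finset.Icc 1 (2 * m)).filter (fun x => x ≠ a),
                ((α a - α a') * (-α a'))))
      + (-1 : FractionRing (MvPolynomial (Fin m) ℝ)) ^ (m + 1) *
          (∑ a ∈ Finset.Icc 1 (2 * m),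
            (1 / ∏ a' ∈ (Finset.Icc 0 (2 * m)).filter
                  (fun x => x ≠ a ∧ x ≠ 2 * m + 1 - a),
                (-α a' - α a)) *
              (-((∏ i : Fin m, lam i) / (2 * α a)))) ^ 2 := by
  have hX : ∀ i, lam i ≠ 0 := fun i => by
    rw [hlam]
    exact (map_ne_zero_iff _ (IsFractionRing.injective _ _)).mpr (MvPolynomial.X_ne_zero i)
  have hinj : Function.Injective fun i => lam i ^ 2 := by
    intro i j h
    simp only [hlam, ← map_pow] at h
    exact MvPolynomial.X_sq_injective (Fin m) ℝ (IsFractionRing.injective _ _ h)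
  have : Nonempty (Fin m) := ⟨⟨0, hm⟩⟩
  have hP : ∏ i, lam i ≠ 0 := Finset.prod_ne_zero_iff.mpr fun i _ => hX i
  rw [degree_two_vertex_contribution hX hα1 hα2, chain_edge_contribution hα0 hα1 hα2,
    sum_inv_mul_prod_sub _ hinj fun i => pow_ne_zero 2 (hX i), Fintype.card_fin,
    Finset.prod_pow, mul_pow, div_pow, ← pow_mul, mul_comm (m + 1) 2, pow_mul]
  field_simp
  simp
end
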